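/- arXiv:1704.07306 — 2 statements merged into one kernel-verified Lean document; each statement's English description precedes it below -/
import Mathlib

section
/- With M, X, e, f, C, A, M', C', A' and ω as in the setup: suppose i₁, i₂ ∈ X−e are distinct rows and j₁, j₂ ∈ (E−X)−f are distinct columns such that A_{i₁j₁} = a ≠ 0, A_{i₂j₂} = b ≠ 0, A_{i₁j₂} = A_{i₂j₁} = 0, and correspondingly A'_{i₁j₁} = x ≠ 0, A'_{i₂j₂} = y ≠ 0, A'_{i₁j₂} = A'_{i₂j₁} = 0. Then a = b if and only if x ≠ y. -/
open Matroid Set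
open scoped Classical

namespace Relax

variable {α β : Type*}

/-- A circuit of a matroid: a minimal dependent set. -/
def Circuit (M : Matroid α) (C : Set α) : Prop :=
  M.Dep C ∧ ∀ D ⊂ C, M.Indep D

/-- A hyperplane of a matroid: a maximal proper flat. -/
def Hyperplane (M : Matroid α) (H : Set α) : Prop :=
  M.IsFlat H ∧ H ≠ M.E ∧ ∀ F, M.IsFlat F → H ⊂ F → F = M.E

/-- `X` is a circuit-hyperplane of `M`. -/
def CircuitHyperplane (M : Matroid α) (X : Set α) : Prop :=
  Circuit M X ∧ Hyperplane M X

/-- `M'` is obtained from `M` by relaxing the circuit-hyperplane `X` : the ground set is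
unchanged and the bases of `M'` are exactly the bases of `M` together with `X`. -/
def IsRelaxation (M M' : Matroid α) (X : Set α) : Prop :=
  CircuitHyperplane M X ∧ M'.E = M.E ∧ ∀ B, (M'.IsBase B ↔ M.IsBase B ∨ B = X)

/-- A matroid is representable over a field `F` if there is an assignment of vectors to its
elements under which independence coincides with linear independence. -/
def Representable (M : Matroid α) (F : Type*) [Field F] : Prop :=
  ∃ (n : ℕ) (φ : α → (Fin n → F)), ∀ I ⊆ M.E,
    (M.Indep I ↔ LinearIndependent F (fun x : I => φ (x : α)))

/-- The field GF(4). -/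
abbrev GF4 := GaloisField 2 2

/-- The rank of a set in a matroid: the maximum size of an independent subset. -/
noncomputable def rk (M : Matroid α) (X : Set α) : ℕ :=
  sSup {n | ∃ I, M.Indep I ∧ I ⊆ X ∧ I.ncard = n}

/-- Deletion of a set of elements. -/
def delete (M : Matroid α) (D : Set α) : Matroid α := M ↾ (M.E \ D)

/-- Contraction of a set of elements. -/
def contract (M : Matroid α) (C : Set α) : Matroid α := (delete M✶ C)✶

/-- `N` is a minor of `M`. -/
def MinorOf (N M : Matroid α) : Prop :=
  ∃ C D, C ⊆ M.E ∧ D ⊆ M.E ∧ Disjoint C D ∧ N = delete (contract M C) D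

/-- Isomorphism of matroids. -/
def Iso (M : Matroid α) (N : Matroid β) : Prop :=
  ∃ e : M.E ≃ N.E, ∀ I : Set M.E,
    M.Indep ((↑) '' I) ↔ N.Indep ((↑) '' (e '' I))

/-- `M` has a minor isomorphic to `N`. -/
def HasMinorIso (M : Matroid α) (N : Matroid β) : Prop :=
  ∃ M₀ : Matroid α, MinorOf M₀ M ∧ Iso M₀ N

/-- `M` has a minor isomorphic to a member of the set `𝒩` of matroids. -/
def HasMinorIn (M : Matroid α) (𝒩 : Set (Matroid β)) : Prop :=
  ∃ N ∈ 𝒩, HasMinorIso M N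

/-- `M` is `𝒩`-fragile. -/
def Fragile (M : Matroid α) (𝒩 : Set (Matroid β)) : Prop :=
  HasMinorIn M 𝒩 ∧
    ∀ a ∈ M.E, ¬ (HasMinorIn (delete M {a}) 𝒩 ∧ HasMinorIn (contract M {a}) 𝒩)

/-- `M` is (isomorphic to) the uniform matroid `U_{r,n}`. -/
def IsUniform (M : Matroid α) (r n : ℕ) : Prop :=
  M.E.Finite ∧ M.E.ncard = n ∧ ∀ I ⊆ M.E, (M.Indep I ↔ I.ncard ≤ r)

/-- `M` has a minor isomorphic to `U_{r,n}`. -/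
def HasUnifMinor (M : Matroid α) (r n : ℕ) : Prop :=
  ∃ M₀, MinorOf M₀ M ∧ IsUniform M₀ r n

/-- `M` has a `{U_{2,5}, U_{3,5}}`-minor. -/
def HasU25U35Minor (M : Matroid α) : Prop :=
  HasUnifMinor M 2 5 ∨ HasUnifMinor M 3 5

/-- `M` is `U_{2,4}`-fragile. -/
def FragileU24 (M : Matroid α) : Prop :=
  HasUnifMinor M 2 4 ∧
    ∀ a ∈ M.E, ¬ (HasUnifMinor (delete M {a}) 2 4 ∧ HasUnifMinor (contract M {a}) 2 4)

/-- `M` is `{U_{2,5}, U_{3,5}}`-fragile. -/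
def FragileU25U35 (M : Matroid α) : Prop :=
  HasU25U35Minor M ∧
    ∀ a ∈ M.E, ¬ (HasU25U35Minor (delete M {a}) ∧ HasU25U35Minor (contract M {a}))

/-- A loop. -/
def Loop (M : Matroid α) (x : α) : Prop := x ∈ M.E ∧ ¬ M.Indep {x}

/-- Two distinct non-loop elements are parallel if they form a two-element circuit. -/
def Parallel (M : Matroid α) (x y : α) : Prop := x ≠ y ∧ Circuit M {x, y}

/-- A parallel class: a maximal set of pairwise-parallel non-loop elements. -/
def ParallelClass (M : Matroid α) (A : Set α) : Prop :=
  A ⊆ M.E ∧ (∀ x ∈ A, ¬ Loop M x) ∧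
    (∀ x ∈ A, ∀ y ∈ A, x ≠ y → Parallel M x y) ∧
    (∀ B, A ⊆ B → B ⊆ M.E → (∀ x ∈ B, ¬ Loop M x) →
      (∀ x ∈ B, ∀ y ∈ B, x ≠ y → Parallel M x y) → B = A)

/-- A series class: a parallel class of the dual. -/
def SeriesClass (M : Matroid α) (A : Set α) : Prop := ParallelClass M✶ A

/-- A matroid is connected if every two distinct elements lie in a common circuit. -/
def Connected (M : Matroid α) : Prop :=
  ∀ x ∈ M.E, ∀ y ∈ M.E, x ≠ y → ∃ C, Circuit M C ∧ x ∈ C ∧ y ∈ C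

/-- A `k`-separation of `M`. -/
def Separation (M : Matroid α) (k : ℕ) (A B : Set α) : Prop :=
  A ∪ B = M.E ∧ Disjoint A B ∧ k ≤ A.ncard ∧ k ≤ B.ncard ∧
    rk M A + rk M B ≤ rk M M.E + (k - 1)

/-- A matroid is 3-connected if it is connected and has no 2-separation. -/
def ThreeConnected (M : Matroid α) : Prop :=
  Connected M ∧ ∀ A B, ¬ Separation M 2 A B

/-- `M` is 3-connected up to series and parallel classes. -/
def ThreeConnUpToSP (M : Matroid α) : Prop :=
  Connected M ∧ ∀ A B, Separation M 2 A B →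
    (SeriesClass M A ∨ ParallelClass M A ∨ SeriesClass M B ∨ ParallelClass M B)

/-- A 3-separating set of `M`. -/
def ThreeSeparating (M : Matroid α) (Y : Set α) : Prop :=
  Y ⊆ M.E ∧ rk M Y + rk M (M.E \ Y) ≤ rk M M.E + 2

/-- `M` has path width 3: there is an ordering of the ground set all of whose initial
segments are 3-separating. -/
def PathWidth3 (M : Matroid α) : Prop :=
  ∃ (n : ℕ) (e : Fin n → α), Function.Injective e ∧ Set.range e = M.E ∧
    ∀ t : Fin n, ThreeSeparating M (e '' {i | i ≤ t})

/-- A segment: every 3-element subset is a triangle. -/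
def Segment (M : Matroid α) (S : Set α) : Prop :=
  S ⊆ M.E ∧ ∀ T ⊆ S, T.ncard = 3 → Circuit M T

/-- A triangle: a 3-element circuit. -/
def Triangle (M : Matroid α) (S : Set α) : Prop := Circuit M S ∧ S.ncard = 3

/-! ### Reduced representations `[I | C]` with `C = [[A, 1], [1ᵀ, w]]` -/

/-- The column, indexed by `x`, of the matrix `[I | C]` whose rows are indexed by
`(X \ {e}) ∪ {f}`, where `C` is the block matrix `[[A, 1], [1ᵀ, w]]` with row block `X \ {e}`,
column block `(E \ X) \ {f}`, last column `e`, last row `f`, and corner entry `w`. -/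
noncomputable def colVec (X : Set α) (e f : α) (A : α → α → GF4) (w : GF4) :
    α → ((X \ {e} ∪ {f} : Set α) → GF4) := fun x r =>
  if x ∈ X \ {e} ∪ ({f} : Set α) then (if (r : α) = x then 1 else 0)
  else if (r : α) = f then (if x = e then w else 1)
  else if x = e then 1 else A (r : α) x

/-- `M = M[I | C]` where `C` is the block matrix `[[A, 1], [1ᵀ, w]]` relative to the
basis `(X \ {e}) ∪ {f}`. -/
def RepBy (M : Matroid α) (X : Set α) (e f : α) (A : α → α → GF4) (w : GF4) : Prop :=
  ∀ I ⊆ M.E, (M.Indep I ↔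
    LinearIndependent GF4 (fun x : I => colVec X e f A w (x : α)))

/-- The matrix `B`, with rows restricted to `R` and columns restricted to `K`, has an
`m × n` submatrix (up to permuting rows and columns) equal to the pattern `P`. -/
def HasPattern {m n : ℕ} (B : α → α → GF4) (R K : Set α) (P : Fin m → Fin n → GF4) : Prop :=
  ∃ (r : Fin m → α) (c : Fin n → α), Function.Injective r ∧ Function.Injective c ∧
    (∀ i, r i ∈ R) ∧ (∀ j, c j ∈ K) ∧ ∀ i j, B (r i) (c j) = P i j

/-- One non-zero element of GF(4). -/
def NZ1 (x : GF4) : Prop := x ≠ 0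

/-- Two distinct non-zero elements of GF(4). -/
def NZ2 (x y : GF4) : Prop := x ≠ 0 ∧ y ≠ 0 ∧ x ≠ y

/-- Three distinct non-zero elements of GF(4). -/
def NZ3 (x y z : GF4) : Prop :=
  x ≠ 0 ∧ y ≠ 0 ∧ z ≠ 0 ∧ x ≠ y ∧ x ≠ z ∧ y ≠ z

/-- `B` (with rows from `R` and columns from `K`) contains one of the fifteen forbidden
submatrices, up to permuting rows and columns, where `x, y, z` denote distinct non-zero
elements of GF(4). -/
def HasForbidden (B : α → α → GF4) (R K : Set α) : Prop :=
  (∃ x y z, NZ3 x y z ∧ HasPattern B R K ![![x, y, z]]) ∨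
  (∃ x y, NZ2 x y ∧ HasPattern B R K ![![x, y], ![0, x]]) ∨
  (∃ x y, NZ2 x y ∧ HasPattern B R K ![![x, y], ![y, x]]) ∨
  (∃ x y z, NZ3 x y z ∧ HasPattern B R K ![![x, y], ![z, x]]) ∨
  (∃ x y z, NZ3 x y z ∧ HasPattern B R K ![![x, x], ![y, z]]) ∨
  (∃ x, NZ1 x ∧ HasPattern B R K ![![x, x, 0], ![x, 0, x]]) ∨
  (∃ x y, NZ2 x y ∧ HasPattern B R K ![![x, x, 0], ![x, 0, y]]) ∨
  (∃ x y, NZ2 x y ∧ HasPattern B R K ![![x, x, 0], ![y, 0, y]]) ∨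
  (∃ x y, NZ2 x y ∧ HasPattern B R K ![![x, y, 0], ![x, 0, y]]) ∨
  (∃ x y z, NZ3 x y z ∧ HasPattern B R K ![![x, 0, 0], ![0, y, z]]) ∨
  (∃ x, NZ1 x ∧ HasPattern B R K ![![x, 0, 0], ![0, x, 0], ![0, 0, x]]) ∨
  (∃ x y, NZ2 x y ∧ HasPattern B R K ![![x, 0, 0], ![0, x, 0], ![0, 0, y]]) ∨
  (∃ x y z, NZ3 x y z ∧ HasPattern B R K ![![x, 0, 0], ![0, y, 0], ![0, 0, z]]) ∨
  (∃ x y, NZ2 x y ∧ HasPattern B R K ![![x, y, x], ![y, y, 0], ![x, 0, 0]]) ∨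
  (∃ x y z, NZ3 x y z ∧ HasPattern B R K ![![x, y, x], ![y, y, 0], ![x, 0, z]])

/-! ### The matroids `P₈⁻`, `F₇⁼` and its dual -/

/-- The columns of the GF(3)-matrix `[I₄ | A]` representing `P₈`, where
`A = [[0,1,1,-1],[1,0,1,1],[1,1,0,1],[-1,1,1,0]]`. -/
def P8cols : Fin 8 → Fin 4 → ZMod 3 :=
  ![![1, 0, 0, 0], ![0, 1, 0, 0], ![0, 0, 1, 0], ![0, 0, 0, 1],
    ![0, 1, 1, -1], ![1, 0, 1, 1], ![1, 1, 0, 1], ![-1, 1, 1, 0]]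

/-- `M` is isomorphic to `P₈`. -/
def IsP8 (M : Matroid α) : Prop :=
  ∃ g : α → Fin 8, Set.BijOn g M.E Set.univ ∧
    ∀ I ⊆ M.E, (M.Indep I ↔ LinearIndependent (ZMod 3) (fun x : I => P8cols (g (x : α))))

/-- `M` is isomorphic to `P₈⁻`: it is obtained from a copy of `P₈` by relaxing one of its
pair of disjoint circuit-hyperplanes. -/
def IsP8Minus (M : Matroid α) : Prop :=
  ∃ (N : Matroid α) (X Y : Set α), IsP8 N ∧ CircuitHyperplane N Y ∧ Disjoint X Y ∧
    IsRelaxation N M X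

/-- The columns of the rational matrix representing the non-Fano matroid `F₇⁻`: the seven
non-zero `{0,1}`-vectors of length 3. -/
def F7cols : Fin 7 → Fin 3 → ℚ :=
  ![![1, 0, 0], ![0, 1, 0], ![0, 0, 1], ![1, 1, 0], ![1, 0, 1], ![0, 1, 1], ![1, 1, 1]]

/-- `M` is isomorphic to the non-Fano matroid `F₇⁻`. -/
def IsF7Minus (M : Matroid α) : Prop :=
  ∃ g : α → Fin 7, Set.BijOn g M.E Set.univ ∧
    ∀ I ⊆ M.E, (M.Indep I ↔ LinearIndependent ℚ (fun x : I => F7cols (g (x : α))))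

/-- `M` is isomorphic to `F₇⁼`: it is obtained from a copy of `F₇⁻` by relaxing a
circuit-hyperplane. -/
def IsF7Eq (M : Matroid α) : Prop :=
  ∃ (N : Matroid α) (X : Set α), IsF7Minus N ∧ IsRelaxation N M X

end Relax

namespace Relax

variable {α : Type*}

/-- A set obtained from a subset of the unit vectors by adjoining further vectors is independent
if and only if the further vectors are independent on the missing coordinates. -/
theorem linearIndepOn_unit_union_iff {ι F : Type*} [Field F] {R : Set ι} (v : ι → R → F)
    (U T : Finset ι) (hUR : (U : Set ι) ⊆ R) (hUT : Disjoint U T)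
    (hv : ∀ u ∈ U, ∀ r : R, v u r = if (r : ι) = u then 1 else 0) :
    LinearIndepOn F v ((U ∪ T : Finset ι) : Set ι) ↔
      ∀ c : ι → F, (∀ r : R, (r : ι) ∉ U → ∑ t ∈ T, c t * v t r = 0) → ∀ t ∈ T, c t = 0 := by
  have hsum (c : ι → F) (r : R) : (∑ u ∈ U, c u • v u) r = if (r : ι) ∈ U then c r else 0 := by
    rw [Finset.sum_apply, ← Finset.sum_ite_eq U (r : ι) c]
    refine Finset.sum_congr rfl fun u hu => ?_
    simp [hv u hu]
  rw [linearIndepOn_finset_iff]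
  constructor
  · intro h c hc
    let c' : ι → F := fun i =>
      if hi : i ∈ U then -∑ t ∈ T, c t * v t ⟨i, hUR hi⟩ else c i
    have hT : ∀ t ∈ T, c' t = c t := fun t ht =>
      dif_neg (Finset.disjoint_right.mp hUT ht)
    intro t ht
    rw [← hT t ht]
    refine h c' ?_ t (Finset.mem_union_right _ ht)
    have hTsum : ∑ t ∈ T, c' t • v t = ∑ t ∈ T, c t • v t :=
      Finset.sum_congr rfl fun t ht => by rw [hT t ht]
    rw [Finset.sum_union hUT, hTsum]
    ext r
    rw [Pi.add_apply, hsum, Finset.sum_apply]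
    by_cases hr : (r : ι) ∈ U
    · simp [c', hr]
    · simpa [hr] using hc r hr
  · intro h c hc
    rw [Finset.sum_union hUT] at hc
    have hr (r : R) : (if (r : ι) ∈ U then c r else 0) + ∑ t ∈ T, c t * v t r = 0 := by
      have := congrFun hc r
      rw [Pi.add_apply, hsum, Finset.sum_apply] at this
      simpa using this
    have hT := h c fun r hrU => by simpa [hrU] using hr r
    intro i hi
    rcases Finset.mem_union.mp hi with hi | hi
    · have := hr ⟨i, hUR hi⟩
      rw [Finset.sum_eq_zero fun t ht => by rw [hT t ht, zero_mul]] at this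
      simpa [hi] using this
    · exact hT i hi

theorem RepBy.indep_iff {M : Matroid α} {X : Set α} {e f : α} {A : α → α → GF4} {w : GF4}
    (h : RepBy M X e f A w) (hfin : M.E.Finite) (hX : X ⊆ M.E) (he : e ∈ X) (hf : f ∉ X)
    (S T : Finset α) (hS : (S : Set α) ⊆ X \ {e}) (hT : (T : Set α) ⊆ (M.E \ X) \ {f}) :
    M.Indep (X \ S ∪ T) ↔
      ∀ c : α → GF4, (∀ i ∈ S, ∑ t ∈ T, c t * A i t + c e = 0) →
        ∑ t ∈ T, c t + c e * w = 0 → c e = 0 ∧ ∀ t ∈ T, c t = 0 := by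
  obtain ⟨Y, rfl⟩ := (hfin.subset hX).exists_finset_coe
  have hTY : ∀ t ∈ T, t ∈ M.E ∧ t ∉ Y ∧ t ≠ f := fun t ht => by
    simpa [and_assoc] using hT ht
  have hSY : ∀ i ∈ S, i ∈ Y ∧ i ≠ e := fun i hi => by simpa using hS hi
  have he' : e ∈ Y := he
  have hf' : f ∉ Y := hf
  have hef : e ≠ f := fun h => hf' (h ▸ he')
  have heT : e ∉ T := fun h => (hTY e h).2.1 he'
  have hset : ((Y : Set α) \ S ∪ T) = (((Y \ S).erase e ∪ insert e T : Finset α) : Set α) := by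
    ext z
    simp only [mem_union, mem_sdiff, Finset.mem_coe, Finset.mem_union, Finset.mem_erase,
      Finset.mem_sdiff, Finset.mem_insert]
    by_cases hz : z = e
    · subst hz
      have : z ∉ S := fun h => (hSY z h).2 rfl
      simp [he', this]
    · simp [hz]
  have hsub : ((Y : Set α) \ S ∪ T) ⊆ M.E :=
    union_subset (sdiff_subset.trans hX) fun t ht => (hTY t ht).1
  have hcolT : ∀ t ∈ T, ∀ r, colVec (Y : Set α) e f A w t r =
      if (r : α) = f then 1 else A r t := fun t ht r => by
    have hte : t ≠ e := fun h => heT (h ▸ ht)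
    simp [colVec, (hTY t ht).2.1, (hTY t ht).2.2, hte]
  have hcole : ∀ r, colVec (Y : Set α) e f A w e r = if (r : α) = f then w else 1 := fun r => by
    simp [colVec, hef]
  rw [h _ hsub]
  change LinearIndepOn GF4 (colVec (Y : Set α) e f A w) _ ↔ _
  rw [hset, linearIndepOn_unit_union_iff]
  · refine forall_congr' fun c => ?_
    have hrow (r : ((Y : Set α) \ {e} ∪ {f} : Set α)) :
        ∑ t ∈ insert e T, c t * colVec (Y : Set α) e f A w t r =
          if (r : α) = f then ∑ t ∈ T, c t + c e * w else ∑ t ∈ T, c t * A r t + c e := by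
      rw [Finset.sum_insert heT, hcole,
        Finset.sum_congr rfl fun t ht => by rw [hcolT t ht r]]
      split_ifs <;> simp [add_comm]
    simp only [hrow, Finset.forall_mem_insert]
    constructor
    · intro H h₁ h₂
      refine H fun r hr => ?_
      split_ifs with hrf
      · exact h₂
      · have hrY : (r : α) ∈ Y ∧ (r : α) ≠ e := by simpa [hrf] using r.2
        refine h₁ r ?_
        by_contra hrS
        exact hr (by simp [hrY, hrS])
    · intro H h₁
      refine H (fun i hi => ?_) ?_
      · have hif : i ≠ f := fun h => hf' (h ▸ (hSY i hi).1)
        simpa [hif] using h₁ ⟨i, Or.inl (hS hi)⟩ (by simp [hi])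
      · simpa using h₁ ⟨f, Or.inr rfl⟩ (by simp [hf'])
  · intro z hz
    simp only [Finset.coe_erase, Finset.coe_sdiff] at hz
    exact Or.inl ⟨hz.1.1, hz.2⟩
  · rw [Finset.disjoint_left]
    intro z hz hz'
    simp only [Finset.mem_erase, Finset.mem_sdiff, Finset.mem_insert] at hz hz'
    exact hz'.elim hz.1 fun h => (hTY z h).2.1 hz.2.1
  · intro u hu r
    simp only [Finset.mem_erase, Finset.mem_sdiff] at hu
    simp [colVec, hu]

theorem IsRelaxation.indep_iff {M M' : Matroid α} {X I : Set α} (h : IsRelaxation M M' X)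
    (hI : ¬ I ⊆ X) : M'.Indep I ↔ M.Indep I := by
  simp only [Matroid.indep_iff, h.2.2]
  constructor
  · rintro ⟨B, hB | rfl, hIB⟩
    · exact ⟨B, hB, hIB⟩
    · exact absurd hIB hI
  · rintro ⟨B, hB, hIB⟩
    exact ⟨B, Or.inl hB, hIB⟩

theorem GF4.sq_add_self_add_one {p : GF4} (h0 : p ≠ 0) (h1 : p ≠ 1) : p ^ 2 + p + 1 = 0 := by
  have hcard : Nat.card GF4 = 4 := by simpa using GaloisField.card 2 2 two_ne_zero
  have : Fintype GF4 := Fintype.ofFinite _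
  have hp : p ^ 4 = p := by
    rw [← hcard, Nat.card_eq_fintype_card, FiniteField.pow_card]
  apply mul_left_cancel₀ (mul_ne_zero h0 (sub_ne_zero.mpr h1))
  linear_combination hp

theorem GF4.mul_mul_add_add_eq_zero {x y w : GF4} (hx : x ≠ 0) (hy : y ≠ 0) (hw : w ≠ 0)
    (hxw : x * w ≠ 1) (hyw : y * w ≠ 1) (hxy : x ≠ y) : x * y * w + x + y = 0 := by
  have hp := sq_add_self_add_one (mul_ne_zero hx hw) hxw
  have hq := sq_add_self_add_one (mul_ne_zero hy hw) hyw
  have hsum : x * w + y * w + 1 = 0 := by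
    apply mul_left_cancel₀ (mul_ne_zero hw (sub_ne_zero.mpr hxy))
    linear_combination hp - hq
  apply mul_left_cancel₀ hw
  linear_combination (x * w + 1) * hsum - hp

section Diagonal

variable {M : Matroid α} {X : Set α} {e f : α} {A : α → α → GF4} {w : GF4} {i₁ i₂ j₁ j₂ : α}

theorem RepBy.indep_exchange_iff (h : RepBy M X e f A w) (hfin : M.E.Finite) (hX : X ⊆ M.E)
    (he : e ∈ X) (hf : f ∉ X) (hi : i₁ ∈ X \ {e}) (hj : j₁ ∈ (M.E \ X) \ {f}) :
    M.Indep (X \ {i₁} ∪ {j₁}) ↔ A i₁ j₁ * w ≠ 1 := by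
  have hej : e ≠ j₁ := fun h => hj.1.2 (h ▸ he)
  have h2 : (2 : GF4) = 0 := CharTwo.two_eq_zero
  have key := h.indep_iff hfin hX he hf {i₁} {j₁} (by simpa using hi) (by simpa using hj)
  simp only [Finset.coe_singleton, Finset.mem_singleton, forall_eq, Finset.sum_singleton] at key
  rw [key]
  constructor
  · intro H hw
    have := H (fun z => if z = e then 1 else w)
    simp only [hej.symm, if_true, if_false] at this
    exact one_ne_zero (this (by linear_combination hw + h2) (by linear_combination w * h2)).1
  · intro hw c h₁ h₂
    have hc : c e = 0 := by
      apply mul_left_cancel₀ (sub_ne_zero.mpr hw)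
      linear_combination A i₁ j₁ * h₂ - h₁
    exact ⟨hc, by simpa [hc] using h₂⟩

theorem RepBy.indep_diagonal_exchange_iff (h : RepBy M X e f A w) (hfin : M.E.Finite)
    (hX : X ⊆ M.E) (he : e ∈ X) (hf : f ∉ X) (hi₁ : i₁ ∈ X \ {e}) (hi₂ : i₂ ∈ X \ {e})
    (hj₁ : j₁ ∈ (M.E \ X) \ {f}) (hj₂ : j₂ ∈ (M.E \ X) \ {f}) (hjj : j₁ ≠ j₂)
    (ha : A i₁ j₁ ≠ 0) (hb : A i₂ j₂ ≠ 0) (hz₁ : A i₁ j₂ = 0) (hz₂ : A i₂ j₁ = 0) :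
    M.Indep (X \ {i₁, i₂} ∪ {j₁, j₂}) ↔
      A i₁ j₁ * A i₂ j₂ * w + A i₁ j₁ + A i₂ j₂ ≠ 0 := by
  have hej₁ : e ≠ j₁ := fun h => hj₁.1.2 (h ▸ he)
  have hej₂ : e ≠ j₂ := fun h => hj₂.1.2 (h ▸ he)
  have h2 : (2 : GF4) = 0 := CharTwo.two_eq_zero
  have key := h.indep_iff hfin hX he hf {i₁, i₂} {j₁, j₂}
    (by simpa [insert_subset_iff] using And.intro hi₁ hi₂)
    (by simpa [insert_subset_iff] using And.intro hj₁ hj₂)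
  simp only [Finset.coe_insert, Finset.coe_singleton, Finset.forall_mem_insert,
    Finset.mem_singleton, forall_eq, Finset.sum_pair hjj, hz₁, hz₂] at key
  rw [key]
  generalize A i₁ j₁ = a at *
  generalize A i₂ j₂ = b at *
  constructor
  · intro H hw
    have := H (fun z => if z = e then a * b else if z = j₁ then b else a)
    simp only [hej₁.symm, hej₂.symm, hjj.symm, if_true, if_false] at this
    exact mul_ne_zero ha hb (this ⟨by linear_combination a * b * h2,
      by linear_combination a * b * h2⟩ (by linear_combination hw)).1
  · rintro hw c ⟨h₁, h₂⟩ h₃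
    have hc : c e = 0 := by
      apply mul_left_cancel₀ hw
      linear_combination a * b * h₃ - b * h₁ - a * h₂ + (a + b) * c e * h2
    exact ⟨hc, by simpa [hc, ha] using h₁, by simpa [hc, hb] using h₂⟩

end Diagonal

end Relax

/-- (Diagonal lemma.) With the setup as given: suppose `i₁, i₂ ∈ X − e` are
distinct rows and `j₁, j₂ ∈ (E − X) − f` are distinct columns such that `A` has the submatrix
`[[a,0],[0,b]]` and correspondingly `A'` has the submatrix `[[x,0],[0,y]]`, with
`a, b, x, y` non-zero. Then `a = b` if and only if `x ≠ y`. -/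
theorem statement14 {α : Type*} (M M' : Matroid α) (X : Set α) (e f : α)
    (A A' : α → α → Relax.GF4) (w : Relax.GF4)
    (hfin : M.E.Finite)
    (hrel : Relax.IsRelaxation M M' X)
    (he : e ∈ X) (hf : f ∈ M.E \ X)
    (hB : M.IsBase (X \ {e} ∪ {f}))
    (hA : Relax.RepBy M X e f A 0)
    (hw0 : w ≠ 0) (hw1 : w ≠ 1)
    (hA' : Relax.RepBy M' X e f A' w)
    (i₁ i₂ j₁ j₂ : α) (a b x y : Relax.GF4)
    (hi₁ : i₁ ∈ X \ {e}) (hi₂ : i₂ ∈ X \ {e}) (hii : i₁ ≠ i₂)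
    (hj₁ : j₁ ∈ (M.E \ X) \ {f}) (hj₂ : j₂ ∈ (M.E \ X) \ {f}) (hjj : j₁ ≠ j₂)
    (ha : A i₁ j₁ = a) (ha0 : a ≠ 0)
    (hb : A i₂ j₂ = b) (hb0 : b ≠ 0)
    (hz1 : A i₁ j₂ = 0) (hz2 : A i₂ j₁ = 0)
    (hx : A' i₁ j₁ = x) (hx0 : x ≠ 0)
    (hy : A' i₂ j₂ = y) (hy0 : y ≠ 0)
    (hz1' : A' i₁ j₂ = 0) (hz2' : A' i₂ j₁ = 0) :
    a = b ↔ x ≠ y := by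
  have hX : X ⊆ M.E := hrel.1.1.1.subset_ground
  have hE : M'.E = M.E := hrel.2.1
  have hfin' : M'.E.Finite := hE ▸ hfin
  have hX' : X ⊆ M'.E := hE ▸ hX
  have single {i j : α} (hi : i ∈ X \ {e}) (hj : j ∈ (M.E \ X) \ {f}) : A' i j * w ≠ 1 := by
    rw [← hA'.indep_exchange_iff hfin' hX' he hf.2 hi (hE ▸ hj),
      hrel.indep_iff fun h => hj.1.2 (h (Or.inr rfl)),
      hA.indep_exchange_iff hfin hX he hf.2 hi hj]
    simp
  have hxw := single hi₁ hj₁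
  have hyw := single hi₂ hj₂
  have hdiag := hrel.indep_iff (I := X \ {i₁, i₂} ∪ {j₁, j₂})
    fun h => hj₁.1.2 (h (Or.inr (Or.inl rfl)))
  subst ha hb hx hy
  rw [hA'.indep_diagonal_exchange_iff hfin' hX' he hf.2 hi₁ hi₂ (hE ▸ hj₁) (hE ▸ hj₂) hjj hx0 hy0
      hz1' hz2',
    hA.indep_diagonal_exchange_iff hfin hX he hf.2 hi₁ hi₂ hj₁ hj₂ hjj ha0 hb0 hz1 hz2,
    mul_zero, zero_add, not_iff_not] at hdiag
  rw [← CharTwo.add_eq_zero, ← hdiag]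
  constructor
  · intro h hxy
    rw [hxy, add_assoc, CharTwo.add_self_eq_zero, add_zero] at h
    exact mul_ne_zero (mul_ne_zero hy0 hy0) hw0 h
  · exact Relax.GF4.mul_mul_add_add_eq_zero hx0 hy0 hw0 hxw hyw
end

section
/- With M, X, e, f, C, A, M', C', A' and ω as in the setup, A has no submatrix of any of the following forms, where x, y, z are distinct non-zero elements of GF(4): [[x,y],[0,x]]; [[x,y],[y,x]]; [[x,x],[y,z]]; [[x,y],[z,x]]. -/
open Matroid Set
open scoped Classical

namespace Relax

/-- Replacing some of the unit vectors of `F^ι` by other vectors leaves a linearly independent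
family exactly when the corresponding minor is non-zero. -/
lemma linearIndependent_extend_single_iff {F ι m : Type*} [Field F] [Fintype ι] [DecidableEq ι]
    [Fintype m] [DecidableEq m] {S : m → ι} (hS : Function.Injective S) (v : m → ι → F) :
    LinearIndependent F (Function.extend S v fun x => Pi.single x 1) ↔
      (Matrix.of fun i j => v i (S j)).det ≠ 0 := by
  set N : Matrix ι ι F := Matrix.of (Function.extend S v fun x => Pi.single x 1) with hN
  have hunit (x : ι) (hx : x ∉ range S) (y : ι) : N x y = (1 : Matrix ι ι F) x y := by
    have : Function.extend S v (fun x => Pi.single x 1) x = Pi.single x 1 :=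
      Function.extend_apply' _ _ _ (by simpa using hx)
    simp [hN, this, Matrix.one_apply, Pi.single_apply, eq_comm]
  have hdet : N.det = (Matrix.of fun i j => v i (S j)).det := by
    rw [Matrix.twoBlockTriangular_det N (· ∈ range S)]
    · have h1 : N.toSquareBlockProp (fun i => i ∉ range S) = 1 := by
        ext x y
        simp [Matrix.toSquareBlockProp_def, hunit x x.2, Matrix.one_apply, Subtype.ext_iff]
      rw [h1, Matrix.det_one, mul_one]
      let σ : m ≃ {x // x ∈ range S} := Equiv.ofInjective S hS
      have h2 : (Matrix.of fun i j => v i (S j)) =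
          (N.toSquareBlockProp fun x => x ∈ range S).submatrix σ σ := by
        ext i j
        simp [σ, hN, Matrix.toSquareBlockProp_def, hS.extend_apply]
      rw [h2, Matrix.det_submatrix_equiv_self]
      congr!
    · rintro x hx y hy
      rw [hunit x hx, Matrix.one_apply_ne]
      rintro rfl
      exact hx hy
  rw [← hdet, ← isUnit_iff_ne_zero, ← Matrix.isUnit_iff_isUnit_det,
    ← Matrix.linearIndependent_rows_iff_isUnit]
  rfl

lemma isBase_iff_indep_of_encard_eq {α : Type*} {M : Matroid α} {B I : Set α} (hB : M.IsBase B)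
    (hfin : B.Finite) (hI : I.encard = B.encard) : M.IsBase I ↔ M.Indep I := by
  refine ⟨IsBase.indep, fun h => ?_⟩
  obtain ⟨B', hB', hIB'⟩ := h.exists_isBase_superset
  have hcard := hB'.encard_eq_encard_of_isBase hB
  have hfin' : B'.Finite := by
    rwa [← encard_lt_top_iff, hcard, encard_lt_top_iff]
  rwa [hfin'.eq_of_subset_of_encard_le' hIB' (by rw [hcard, hI])]

/-- The entries of the block matrix `[[A, 1], [1ᵀ, w]]`. -/
noncomputable def blockEntry {α : Type*} (e f : α) (A : α → α → GF4) (w : GF4) (r c : α) : GF4 :=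
  if r = f then (if c = e then w else 1) else if c = e then 1 else A r c

section Minors

variable {α : Type*} {M M' : Matroid α} {X : Set α} {e f : α} {A A' : α → α → GF4} {w : GF4}
  {m : Type*} {S T : m → α}

/-- The set obtained from the basis `(X \ {e}) ∪ {f}` by exchanging each `S i` for `T i`. -/
noncomputable def exchange (X : Set α) (e f : α) (S T : m → α) : Set α :=
  range fun x : (X \ {e} ∪ {f} : Set α) => Function.extend S T id (x : α)

lemma mem_exchange (hS : Function.Injective S) (hSB : ∀ i, S i ∈ X \ {e} ∪ {f}) (i : m) :
    T i ∈ exchange X e f S T :=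
  ⟨⟨S i, hSB i⟩, hS.extend_apply _ _ _⟩

lemma exchange_subset {E : Set α} (hS : Function.Injective S) (hB : X \ {e} ∪ {f} ⊆ E)
    (hT : ∀ i, T i ∈ E) : exchange X e f S T ⊆ E := by
  rintro _ ⟨x, rfl⟩
  by_cases hx : ∃ i, S i = x
  · obtain ⟨i, hi⟩ := hx
    simpa [← hi, hS.extend_apply] using hT i
  · simpa [Function.extend_apply' _ _ _ hx] using hB x.2

lemma extend_injective (hS : Function.Injective S) (hT : Function.Injective T)
    (hTB : ∀ i, T i ∉ X \ {e} ∪ {f}) :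
    Function.Injective fun x : (X \ {e} ∪ {f} : Set α) => Function.extend S T id (x : α) := by
  intro x y hxy
  dsimp only at hxy
  by_cases hx : ∃ i, S i = x <;> by_cases hy : ∃ i, S i = y
  · obtain ⟨i, hi⟩ := hx
    obtain ⟨j, hj⟩ := hy
    rw [← hi, ← hj, hS.extend_apply, hS.extend_apply] at hxy
    exact Subtype.ext (by rw [← hi, ← hj, hT hxy])
  · obtain ⟨i, hi⟩ := hx
    rw [← hi, hS.extend_apply, Function.extend_apply' _ _ _ hy] at hxy
    exact absurd (hxy ▸ y.2) (hTB i)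
  · obtain ⟨j, hj⟩ := hy
    rw [← hj, hS.extend_apply, Function.extend_apply' _ _ _ hx] at hxy
    exact absurd (hxy ▸ x.2) (hTB j)
  · rw [Function.extend_apply' _ _ _ hx, Function.extend_apply' _ _ _ hy] at hxy
    exact Subtype.ext hxy

lemma encard_exchange (hS : Function.Injective S) (hT : Function.Injective T)
    (hTB : ∀ i, T i ∉ X \ {e} ∪ {f}) :
    (exchange X e f S T).encard = (X \ {e} ∪ {f}).encard := by
  rw [exchange, ← image_univ, (extend_injective hS hT hTB).encard_image, encard_univ]
  rfl

lemma RepBy.indep_exchange_iff_s17 [Fintype m] [DecidableEq m] (hA : RepBy M X e f A w)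
    (hfin : (X \ {e} ∪ {f}).Finite) (hB : X \ {e} ∪ {f} ⊆ M.E)
    (hS : Function.Injective S) (hT : Function.Injective T)
    (hSB : ∀ i, S i ∈ X \ {e} ∪ {f}) (hTE : ∀ i, T i ∈ M.E) (hTB : ∀ i, T i ∉ X \ {e} ∪ {f}) :
    M.Indep (exchange X e f S T) ↔
      (Matrix.of fun i j => blockEntry e f A w (S j) (T i)).det ≠ 0 := by
  have := hfin.fintype
  rw [hA _ (exchange_subset hS hB hTE)]
  set S' : m → (X \ {e} ∪ {f} : Set α) := fun i => ⟨S i, hSB i⟩ with hS'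
  have hS'inj : Function.Injective S' := fun i j h => hS (congrArg Subtype.val h)
  have key := linearIndependent_extend_single_iff hS'inj fun i => colVec X e f A w (T i)
  have hentry : (Matrix.of fun i j => colVec X e f A w (T i) (S' j)) =
      Matrix.of fun i j => blockEntry e f A w (S j) (T i) := by
    ext i j
    simp only [Matrix.of_apply, colVec, if_neg (hTB i), blockEntry, hS']
  rw [hentry] at key
  rw [← key]
  refine (linearIndependent_equiv' (Equiv.ofInjective _ (extend_injective hS hT hTB)) ?_).symm
  funext x
  change colVec X e f A w (Function.extend S T id (x : α)) = _
  by_cases hx : ∃ i, S' i = x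
  · obtain ⟨i, rfl⟩ := hx
    rw [hS'inj.extend_apply, hS.extend_apply]
  · have hx' : ¬ ∃ i, S i = x := fun ⟨i, hi⟩ => hx ⟨i, Subtype.ext hi⟩
    rw [Function.extend_apply' _ _ _ hx, Function.extend_apply' _ _ _ hx']
    funext r
    simp only [id, colVec, if_pos x.2, Pi.single_apply, Subtype.ext_iff]

/-- Apart from the corner entry, corresponding square submatrices of the representations of a
matroid and of its relaxation are simultaneously singular. -/
lemma IsRelaxation.det_eq_zero_iff [Fintype m] [DecidableEq m] (hrel : IsRelaxation M M' X)
    (hfin : M.E.Finite) (hB : M.IsBase (X \ {e} ∪ {f}))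
    (hA : RepBy M X e f A 0) (hA' : RepBy M' X e f A' w)
    (hS : Function.Injective S) (hT : Function.Injective T)
    (hSB : ∀ i, S i ∈ X \ {e} ∪ {f}) (hTE : ∀ i, T i ∈ M.E) (hTB : ∀ i, T i ∉ X \ {e} ∪ {f})
    (hTX : ∃ i, T i ∉ X) :
    (Matrix.of fun i j => blockEntry e f A 0 (S j) (T i)).det = 0 ↔
      (Matrix.of fun i j => blockEntry e f A' w (S j) (T i)).det = 0 := by
  obtain ⟨-, hE, hbase⟩ := hrel
  have hBfin := hfin.subset hB.subset_ground
  have hB' : M'.IsBase (X \ {e} ∪ {f}) := (hbase _).2 (.inl hB)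
  have hne : exchange X e f S T ≠ X := fun h =>
    hTX.elim fun i hi => hi (h ▸ mem_exchange hS hSB i)
  have hcard := encard_exchange hS hT hTB
  rw [← not_iff_not, ← ne_eq, ← ne_eq,
    ← hA.indep_exchange_iff_s17 hBfin hB.subset_ground hS hT hSB hTE hTB,
    ← hA'.indep_exchange_iff_s17 hBfin hB'.subset_ground hS hT hSB (by rwa [hE]) hTB,
    ← isBase_iff_indep_of_encard_eq hB hBfin hcard,
    ← isBase_iff_indep_of_encard_eq hB' hBfin hcard, hbase, or_iff_left hne]

end Minors

section Field

lemma GF4.pow_three_eq_one {a : GF4} (ha : a ≠ 0) : a ^ 3 = 1 := by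
  have := Fintype.ofFinite GF4
  have hcard : Fintype.card GF4 = 4 := by
    rw [← Nat.card_eq_fintype_card, GaloisField.card 2 2 two_ne_zero]
    norm_num
  simpa [hcard] using FiniteField.pow_card_sub_one_eq_one a ha

lemma GF4.sq_add_mul_add_sq {a b : GF4} (ha : a ≠ 0) (hb : b ≠ 0) (hab : a ≠ b) :
    a ^ 2 + a * b + b ^ 2 = 0 := by
  refine (mul_eq_zero.1 (?_ : (a - b) * _ = 0)).resolve_left (sub_ne_zero.2 hab)
  linear_combination GF4.pow_three_eq_one ha - GF4.pow_three_eq_one hb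

lemma GF4.sq_eq_mul {x y z : GF4} (h : NZ3 x y z) : x ^ 2 = y * z := by
  obtain ⟨hx, hy, hz, hxy, hxz, hyz⟩ := h
  have hsum : x + y + z = 0 := by
    refine (mul_eq_zero.1 (?_ : (y - z) * _ = 0)).resolve_left (sub_ne_zero.2 hyz)
    linear_combination GF4.sq_add_mul_add_sq hx hy hxy - GF4.sq_add_mul_add_sq hx hz hxz
  linear_combination GF4.sq_add_mul_add_sq hx hy hxy - y * hsum

lemma GF4.eq_one_or_eq {a w : GF4} (ha : a ≠ 0) (hw : w ≠ 0) (hw1 : w ≠ 1) (h : a * w ≠ 1) :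
    a = 1 ∨ a = w := by
  by_contra! hne
  refine h ?_
  have := GF4.sq_eq_mul (x := 1) (y := a) (z := w)
    ⟨one_ne_zero, ha, hw, hne.1.symm, hw1.symm, hne.2⟩
  rw [← this, one_pow]

end Field

section Entries

variable {α : Type*} {M M' : Matroid α} {X : Set α} {e f : α} {A A' : α → α → GF4} {w : GF4}

/-- The relations between the entries of a `2 × 2` submatrix `[[a, b], [c, d]]` of `A` and the
corresponding submatrix `[[a', b'], [c', d']]` of `A'`. -/
structure EntryRel (w a b c d a' b' c' d' : GF4) : Prop where
  zero₁₁ : a = 0 ↔ a' = 0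
  zero₁₂ : b = 0 ↔ b' = 0
  zero₂₁ : c = 0 ↔ c' = 0
  zero₂₂ : d = 0 ↔ d' = 0
  row₁ : a = b ↔ a' = b'
  row₂ : c = d ↔ c' = d'
  col₁ : a = c ↔ a' = c'
  col₂ : b = d ↔ b' = d'
  mul_ne₁₁ : a' * w ≠ 1
  mul_ne₁₂ : b' * w ≠ 1
  mul_ne₂₁ : c' * w ≠ 1
  mul_ne₂₂ : d' * w ≠ 1
  det : a * d = b * c ↔ a' * d' = b' * c'
  sum : a + b + c + d = 0 ↔ a' + b' + c' + d' + w * (a' * d' - b' * c') = 0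

lemma IsRelaxation.entryRel (hrel : IsRelaxation M M' X) (hfin : M.E.Finite)
    (he : e ∈ X) (hf : f ∈ M.E \ X) (hB : M.IsBase (X \ {e} ∪ {f}))
    (hA : RepBy M X e f A 0) (hA' : RepBy M' X e f A' w) {i j k l : α}
    (hi : i ∈ X \ {e}) (hj : j ∈ X \ {e}) (hk : k ∈ (M.E \ X) \ {f}) (hl : l ∈ (M.E \ X) \ {f})
    (hij : i ≠ j) (hkl : k ≠ l) :
    EntryRel w (A i k) (A i l) (A j k) (A j l) (A' i k) (A' i l) (A' j k) (A' j l) := by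
  have hchar : (2 : GF4) = 0 := CharTwo.two_eq_zero
  have hEe : e ∈ M.E := hrel.1.1.1.subset_ground he
  have hrow {r : α} (hr : r ∈ X \ {e}) : r ≠ f := fun h => hf.2 (h ▸ hr.1)
  have hcol {c : α} (hc : c ∈ (M.E \ X) \ {f}) : c ≠ e := fun h => hc.1.2 (h ▸ he)
  have hfe : e ≠ f := fun h => hf.2 (h ▸ he)
  have hcol' {c : α} (hc : c ∈ (M.E \ X) \ {f}) : c ∉ X \ {e} ∪ {f} := by
    rintro (h | h)
    exacts [hc.1.2 h.1, hc.2 h]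
  have he' : e ∉ X \ {e} ∪ {f} := by simp [hfe]
  have inj₂ {x y : α} (h : x ≠ y) : Function.Injective ![x, y] := by
    intro a b; fin_cases a <;> fin_cases b <;> simp [h, h.symm]
  have inj₃ {x y z : α} (h : x ≠ y) (h' : x ≠ z) (h'' : y ≠ z) :
      Function.Injective ![x, y, z] := by
    intro a b
    fin_cases a <;> fin_cases b <;> simp [h, h.symm, h', h'.symm, h'', h''.symm]
  have zero {r c : α} (hr : r ∈ X \ {e}) (hc : c ∈ (M.E \ X) \ {f}) :
      A r c = 0 ↔ A' r c = 0 := by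
    have := hrel.det_eq_zero_iff hfin hB hA hA' (S := ![r]) (T := ![c])
      (Function.injective_of_subsingleton _) (Function.injective_of_subsingleton _)
      (by simpa [Fin.forall_fin_succ] using .inr hr) (by simpa using hc.1.1)
      (by simpa using hcol' hc) ⟨0, hc.1.2⟩
    simpa [blockEntry, hrow hr, hcol hc] using this
  have row {r c d : α} (hr : r ∈ X \ {e}) (hc : c ∈ (M.E \ X) \ {f})
      (hd : d ∈ (M.E \ X) \ {f}) (hcd : c ≠ d) : A r c = A r d ↔ A' r c = A' r d := by
    have := hrel.det_eq_zero_iff hfin hB hA hA' (S := ![r, f]) (T := ![c, d])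
      (inj₂ (hrow hr)) (inj₂ hcd) (by simpa [Fin.forall_fin_two] using .inr hr)
      (by simpa [Fin.forall_fin_two] using ⟨hc.1.1, hd.1.1⟩)
      (Fin.forall_fin_two.2 ⟨hcol' hc, hcol' hd⟩) ⟨0, hc.1.2⟩
    simpa [blockEntry, Matrix.det_fin_two, hrow hr, hcol hc, hcol hd, sub_eq_zero] using this
  have col {r s c : α} (hr : r ∈ X \ {e}) (hs : s ∈ X \ {e}) (hc : c ∈ (M.E \ X) \ {f})
      (hrs : r ≠ s) : A r c = A s c ↔ A' r c = A' s c := by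
    have := hrel.det_eq_zero_iff hfin hB hA hA' (S := ![r, s]) (T := ![c, e])
      (inj₂ hrs) (inj₂ (hcol hc)) (Fin.forall_fin_two.2 ⟨.inl hr, .inl hs⟩)
      (Fin.forall_fin_two.2 ⟨hc.1.1, hEe⟩) (Fin.forall_fin_two.2 ⟨hcol' hc, he'⟩) ⟨0, hc.1.2⟩
    simpa [blockEntry, Matrix.det_fin_two, hrow hr, hrow hs, hcol hc, sub_eq_zero] using this
  have mul_ne {r c : α} (hr : r ∈ X \ {e}) (hc : c ∈ (M.E \ X) \ {f}) : A' r c * w ≠ 1 := by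
    have := hrel.det_eq_zero_iff hfin hB hA hA' (S := ![r, f]) (T := ![c, e])
      (inj₂ (hrow hr)) (inj₂ (hcol hc)) (Fin.forall_fin_two.2 ⟨.inl hr, .inr rfl⟩)
      (Fin.forall_fin_two.2 ⟨hc.1.1, hEe⟩) (Fin.forall_fin_two.2 ⟨hcol' hc, he'⟩) ⟨0, hc.1.2⟩
    simpa [blockEntry, Matrix.det_fin_two, hrow hr, hcol hc, sub_eq_zero] using this
  refine ⟨zero hi hk, zero hi hl, zero hj hk, zero hj hl, row hi hk hl hkl, row hj hk hl hkl,
    col hi hj hk hij, col hi hj hl hij, mul_ne hi hk, mul_ne hi hl, mul_ne hj hk, mul_ne hj hl,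
    ?_, ?_⟩
  · have := hrel.det_eq_zero_iff hfin hB hA hA' (S := ![i, j]) (T := ![k, l])
      (inj₂ hij) (inj₂ hkl) (Fin.forall_fin_two.2 ⟨.inl hi, .inl hj⟩)
      (Fin.forall_fin_two.2 ⟨hk.1.1, hl.1.1⟩) (Fin.forall_fin_two.2 ⟨hcol' hk, hcol' hl⟩)
      ⟨0, hk.1.2⟩
    simpa [blockEntry, Matrix.det_fin_two, hrow hi, hrow hj, hcol hk, hcol hl, sub_eq_zero,
      mul_comm] using this
  · have := hrel.det_eq_zero_iff hfin hB hA hA' (S := ![i, j, f]) (T := ![k, l, e])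
      (inj₃ hij (hrow hi) (hrow hj)) (inj₃ hkl (hcol hk) (hcol hl))
      (Fin.forall_fin_succ.2 ⟨.inl hi, Fin.forall_fin_two.2 ⟨.inl hj, .inr rfl⟩⟩)
      (Fin.forall_fin_succ.2 ⟨hk.1.1, Fin.forall_fin_two.2 ⟨hl.1.1, hEe⟩⟩)
      (Fin.forall_fin_succ.2 ⟨hcol' hk, Fin.forall_fin_two.2 ⟨hcol' hl, he'⟩⟩) ⟨0, hk.1.2⟩
    simp only [blockEntry, Matrix.det_fin_three, Matrix.of_apply, Matrix.cons_val, hrow hi, hrow hj,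
      hcol hk, hcol hl, if_true, if_false] at this
    convert this using 2
    · linear_combination (A i k + A j l) * hchar
    · linear_combination (A' i k + A' j l) * hchar

namespace EntryRel

variable {x y z a b c d : GF4}

lemma not_zero_corner (h : EntryRel w x y 0 x a b c d) (hw0 : w ≠ 0) (hw1 : w ≠ 1) :
    ¬ NZ2 x y := by
  rintro ⟨hx, hy, hne⟩
  have hchar : (2 : GF4) = 0 := CharTwo.two_eq_zero
  have hc : c = 0 := h.zero₂₁.1 rfl
  have hab : a ≠ b := fun h' => hne (h.row₁.2 h')
  have hbd : b ≠ d := fun h' => hne (h.col₂.2 h').symm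
  have hsum : ¬ (x + y + 0 + x = 0) := fun h' => hy (by linear_combination h' - x * hchar)
  rw [h.sum] at hsum
  have hw3 := GF4.pow_three_eq_one hw0
  apply hsum
  rcases GF4.eq_one_or_eq (mt h.zero₁₁.2 hx) hw0 hw1 h.mul_ne₁₁ with rfl | rfl <;>
  rcases GF4.eq_one_or_eq (mt h.zero₁₂.2 hy) hw0 hw1 h.mul_ne₁₂ with rfl | rfl <;>
  rcases GF4.eq_one_or_eq (mt h.zero₂₂.2 hx) hw0 hw1 h.mul_ne₂₂ with rfl | rfl <;>
  first
    | exact absurd rfl hab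
    | exact absurd rfl hbd
    | skip
  · subst hc
    linear_combination (1 + b) * hchar
  · subst hc
    linear_combination (1 + d) * hchar + hw3

/-- If a `2 × 2` submatrix of `A` has no zeros and, except possibly in its second row, no two equal
entries in a line, then the corresponding submatrix of `A'` is non-singular, of the form
`[[a, b], [b, a]]`. -/
lemma antidiagonal {p q r s : GF4} (h : EntryRel w p q r s a b c d) (hw0 : w ≠ 0) (hw1 : w ≠ 1)
    (hp : p ≠ 0) (hq : q ≠ 0) (hr : r ≠ 0) (hs : s ≠ 0) (hpq : p ≠ q) (hpr : p ≠ r)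
    (hqs : q ≠ s) : a = d ∧ b = c ∧ a * d ≠ b * c := by
  have hab : a ≠ b := mt h.row₁.2 hpq
  have hac : a ≠ c := mt h.col₁.2 hpr
  have hbd : b ≠ d := mt h.col₂.2 hqs
  have hchar : (2 : GF4) = 0 := CharTwo.two_eq_zero
  have hsq {u v : GF4} (huv : u ≠ v) : u * u ≠ v * v := fun h' =>
    huv <| sub_eq_zero.1 <| pow_eq_zero_iff two_ne_zero |>.1
      (by linear_combination h' + (v ^ 2 - u * v) * hchar)
  have had : a = d := by
    rcases GF4.eq_one_or_eq (mt h.zero₁₁.2 hp) hw0 hw1 h.mul_ne₁₁ with h1 | h1 <;>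
    rcases GF4.eq_one_or_eq (mt h.zero₁₂.2 hq) hw0 hw1 h.mul_ne₁₂ with h2 | h2 <;>
    rcases GF4.eq_one_or_eq (mt h.zero₂₂.2 hs) hw0 hw1 h.mul_ne₂₂ with h3 | h3 <;>
    simp_all
  have hbc : b = c := by
    rcases GF4.eq_one_or_eq (mt h.zero₁₁.2 hp) hw0 hw1 h.mul_ne₁₁ with h1 | h1 <;>
    rcases GF4.eq_one_or_eq (mt h.zero₁₂.2 hq) hw0 hw1 h.mul_ne₁₂ with h2 | h2 <;>
    rcases GF4.eq_one_or_eq (mt h.zero₂₁.2 hr) hw0 hw1 h.mul_ne₂₁ with h3 | h3 <;>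
    simp_all
  refine ⟨had, hbc, ?_⟩
  rw [← had, ← hbc]
  exact hsq hab

lemma not_symm (h : EntryRel w x y y x a b c d) (hw0 : w ≠ 0) (hw1 : w ≠ 1) : ¬ NZ2 x y := by
  rintro ⟨hx, hy, hne⟩
  have hchar : (2 : GF4) = 0 := CharTwo.two_eq_zero
  obtain ⟨rfl, rfl, hdet⟩ := h.antidiagonal hw0 hw1 hx hy hy hx hne hne hne.symm
  have hsum := h.sum.1 (by linear_combination (x + y) * hchar)
  have : w * (a * a - b * b) = 0 := by linear_combination hsum - (a + b) * hchar
  exact (mul_ne_zero hw0 (sub_ne_zero.2 hdet)) this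

lemma not_row_eq (h : EntryRel w x x y z a b c d) (hw0 : w ≠ 0) (hw1 : w ≠ 1) :
    ¬ NZ3 x y z := by
  rintro ⟨hx, hy, hz, hxy, hxz, hyz⟩
  have hab : a = b := h.row₁.1 rfl
  have hac : a ≠ c := mt h.col₁.2 hxy
  have hbd : b ≠ d := mt h.col₂.2 hxz
  have hcd : c ≠ d := mt h.row₂.2 hyz
  rcases GF4.eq_one_or_eq (mt h.zero₁₁.2 hx) hw0 hw1 h.mul_ne₁₁ with h1 | h1 <;>
  rcases GF4.eq_one_or_eq (mt h.zero₂₁.2 hy) hw0 hw1 h.mul_ne₂₁ with h2 | h2 <;>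
  rcases GF4.eq_one_or_eq (mt h.zero₂₂.2 hz) hw0 hw1 h.mul_ne₂₂ with h3 | h3 <;>
  simp_all

lemma not_diag_eq (h : EntryRel w x y z x a b c d) (hw0 : w ≠ 0) (hw1 : w ≠ 1) :
    ¬ NZ3 x y z := by
  intro hxyz
  have hsq := GF4.sq_eq_mul hxyz
  obtain ⟨hx, hy, hz, hxy, hxz, hyz⟩ := hxyz
  refine (h.antidiagonal hw0 hw1 hx hy hz hx hxy hxz hxy.symm).2.2 (h.det.1 ?_)
  rw [← hsq, sq]

end EntryRel

lemma IsRelaxation.exists_entryRel (hrel : IsRelaxation M M' X) (hfin : M.E.Finite)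
    (he : e ∈ X) (hf : f ∈ M.E \ X) (hB : M.IsBase (X \ {e} ∪ {f}))
    (hA : RepBy M X e f A 0) (hA' : RepBy M' X e f A' w) {p q r s : GF4}
    (h : HasPattern A (X \ {e}) ((M.E \ X) \ {f}) ![![p, q], ![r, s]]) :
    ∃ a b c d, EntryRel w p q r s a b c d := by
  obtain ⟨i, k, hi, hk, hiR, hkK, hP⟩ := h
  have hrel' := hrel.entryRel hfin he hf hB hA hA' (hiR 0) (hiR 1) (hkK 0) (hkK 1)
    (hi.ne zero_ne_one) (hk.ne zero_ne_one)
  simp only [hP] at hrel'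
  exact ⟨_, _, _, _, hrel'⟩

end Entries

end Relax

/-- With the setup as given, `A` has no submatrix of any of the forms
`[[x,y],[0,x]]`, `[[x,y],[y,x]]`, `[[x,x],[y,z]]`, `[[x,y],[z,x]]`, where `x, y, z` are
distinct non-zero elements of GF(4). -/
theorem statement17 {α : Type*} (M M' : Matroid α) (X : Set α) (e f : α)
    (A A' : α → α → Relax.GF4) (w : Relax.GF4)
    (hfin : M.E.Finite)
    (hrel : Relax.IsRelaxation M M' X)
    (he : e ∈ X) (hf : f ∈ M.E \ X)
    (hB : M.IsBase (X \ {e} ∪ {f}))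
    (hA : Relax.RepBy M X e f A 0)
    (hw0 : w ≠ 0) (hw1 : w ≠ 1)
    (hA' : Relax.RepBy M' X e f A' w) :
    (¬ ∃ x y, Relax.NZ2 x y ∧
      Relax.HasPattern A (X \ {e}) ((M.E \ X) \ {f}) ![![x, y], ![0, x]]) ∧
    (¬ ∃ x y, Relax.NZ2 x y ∧
      Relax.HasPattern A (X \ {e}) ((M.E \ X) \ {f}) ![![x, y], ![y, x]]) ∧
    (¬ ∃ x y z, Relax.NZ3 x y z ∧
      Relax.HasPattern A (X \ {e}) ((M.E \ X) \ {f}) ![![x, x], ![y, z]]) ∧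
    (¬ ∃ x y z, Relax.NZ3 x y z ∧
      Relax.HasPattern A (X \ {e}) ((M.E \ X) \ {f}) ![![x, y], ![z, x]]) := by
  have key {p q r s : Relax.GF4} := hrel.exists_entryRel hfin he hf hB hA hA' (p := p) (q := q)
    (r := r) (s := s)
  refine ⟨?_, ?_, ?_, ?_⟩
  · rintro ⟨x, y, hxy, h⟩
    obtain ⟨a, b, c, d, h⟩ := key h
    exact h.not_zero_corner hw0 hw1 hxy
  · rintro ⟨x, y, hxy, h⟩
    obtain ⟨a, b, c, d, h⟩ := key h
    exact h.not_symm hw0 hw1 hxy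
  · rintro ⟨x, y, z, hxyz, h⟩
    obtain ⟨a, b, c, d, h⟩ := key h
    exact h.not_row_eq hw0 hw1 hxyz
  · rintro ⟨x, y, z, hxyz, h⟩
    obtain ⟨a, b, c, d, h⟩ := key h
    exact h.not_diag_eq hw0 hw1 hxyz
end
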